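/- For all bipartite density matrices ρ_AB on ℂ^{d_A} ⊗ ℂ^{d_B} and σ_{A'B'} on ℂ^{d_{A'}} ⊗ ℂ^{d_{B'}}, the maximal entanglement of the tensor product state (with the AA' systems on one side and the BB' systems on the other) satisfies μ_ent(ρ_AB ⊗ σ_{A'B'}) = max{ μ_ent(ρ_AB), μ_ent(σ_{A'B'}) }. -/

import Mathlib

open scoped Matrix Kronecker ComplexOrder
open Matrix

noncomputable section

/-- Partial trace over the second (B) system. -/
def ptrB {A B : Type*} [Fintype B] (ρ : Matrix (A × B) (A × B) ℂ) : Matrix A A ℂ :=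
  fun i j => ∑ k, ρ (i, k) (j, k)

/-- Partial trace over the first (A) system. -/
def ptrA {A B : Type*} [Fintype A] (ρ : Matrix (A × B) (A × B) ℂ) : Matrix B B ℂ :=
  fun k l => ∑ i, ρ (i, k) (i, l)

/-- A density matrix: positive semidefinite with trace one. -/
def IsDensity {n : Type*} [Fintype n] (ρ : Matrix n n ℂ) : Prop :=
  ρ.PosSemidef ∧ ρ.trace = 1

/-- Maximal correlation of a bipartite state. -/
def mu {A B : Type*} [Fintype A] [Fintype B] (ρ : Matrix (A × B) (A × B) ℂ) : ℝ :=
  sSup {r : ℝ | ∃ (X : Matrix A A ℂ) (Y : Matrix B B ℂ),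
    ((ptrB ρ) * X).trace = 0 ∧ ((ptrA ρ) * Y).trace = 0 ∧
    ((ptrB ρ) * (X * Xᴴ)).trace = 1 ∧ ((ptrA ρ) * (Y * Yᴴ)).trace = 1 ∧
    r = ‖(ρ * (X ⊗ₖ Yᴴ)).trace‖}

/-- Maximal entanglement: infimum over finite decompositions of the max correlation. -/
def muEnt {A B : Type*} [Fintype A] [Fintype B] (ρ : Matrix (A × B) (A × B) ℂ) : ℝ :=
  sInf {r : ℝ | ∃ (m : ℕ) (p : Fin m → ℝ) (τ : Fin m → Matrix (A × B) (A × B) ℂ),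
    (∀ i, 0 ≤ p i) ∧ (∑ i, p i) = 1 ∧ (∀ i, IsDensity (τ i)) ∧
    ρ = ∑ i, p i • τ i ∧ r = ⨆ i, mu (τ i)}

/-- Application of a product channel given by local Kraus operators. -/
def applyLocal {A B A' B' ι κ : Type*} [Fintype A] [Fintype B] [Fintype ι] [Fintype κ]
    (K : ι → Matrix A' A ℂ) (L : κ → Matrix B' B ℂ)
    (ρ : Matrix (A × B) (A × B) ℂ) : Matrix (A' × B') (A' × B') ℂ :=
  ∑ k, ∑ m, (K k ⊗ₖ L m) * ρ * (K k ⊗ₖ L m)ᴴ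

/-- Tensor product of two bipartite states, with the A-systems grouped together. -/
def prodState {A B A' B' : Type*}
    (ρ : Matrix (A × B) (A × B) ℂ) (σ : Matrix (A' × B') (A' × B') ℂ) :
    Matrix ((A × A') × (B × B')) ((A × A') × (B × B')) ℂ :=
  fun x y => ρ (x.1.1, x.2.1) (y.1.1, y.2.1) * σ (x.1.2, x.2.2) (y.1.2, y.2.2)

/-- n-fold tensor power of a bipartite state, with all A-systems grouped together. -/
def powState {A B : Type*} (ρ : Matrix (A × B) (A × B) ℂ) (n : ℕ) :
    Matrix ((Fin n → A) × (Fin n → B)) ((Fin n → A) × (Fin n → B)) ℂ :=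
  fun x y => ∏ i, ρ (x.1 i, x.2 i) (y.1 i, y.2 i)

/-- The two-qubit Bell vector (|00⟩+|11⟩)/√2. -/
def bellVec : Fin 2 × Fin 2 → ℂ := fun p => if p.1 = p.2 then 1 / (Real.sqrt 2 : ℂ) else 0

/-- Inverse of the positive semidefinite square root. -/
def invSqrt {n : Type*} [Fintype n] [DecidableEq n] (M : Matrix n n ℂ) : Matrix n n ℂ :=
  letI := Classical.dec M.PosSemidef
  if h : M.PosSemidef then
    ((h.1.eigenvectorUnitary : Matrix n n ℂ) *
      diagonal ((fun x : ℝ => (x : ℂ)) ∘ Real.sqrt ∘ h.1.eigenvalues) *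
      (star h.1.eigenvectorUnitary : Matrix n n ℂ))⁻¹ else 0

section Blocks

variable {I J I' J' : Type*} [Fintype I] [Fintype J] [Fintype I'] [Fintype J']

theorem star_dotProduct_fromBlocks_mulVec (G : Matrix I I ℂ) (H : Matrix J J ℂ) (C : Matrix J I ℂ)
    (x : I → ℂ) (y : J → ℂ) :
    star (Sum.elim x y) ⬝ᵥ (fromBlocks G Cᴴ C H *ᵥ Sum.elim x y) =
      star x ⬝ᵥ (G *ᵥ x) + star y ⬝ᵥ (H *ᵥ y) +
        (star y ⬝ᵥ (C *ᵥ x) + star (star y ⬝ᵥ (C *ᵥ x))) := by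
  have h1 : star (Sum.elim x y) = Sum.elim (star x) (star y) := by
    ext i; cases i <;> simp
  have h2 : star (star y ⬝ᵥ (C *ᵥ x)) = star x ⬝ᵥ (Cᴴ *ᵥ y) := by
    rw [← star_dotProduct, star_mulVec, ← dotProduct_mulVec]
  rw [h1, fromBlocks_mulVec, sumElim_dotProduct_sumElim, h2]
  simp only [dotProduct_add, Sum.elim_comp_inl, Sum.elim_comp_inr]
  ring

omit [Fintype I] [Fintype J] in
theorem isHermitian_fromBlocks_conjTranspose {G : Matrix I I ℂ} {H : Matrix J J ℂ}
    (C : Matrix J I ℂ) (hG : G.IsHermitian) (hH : H.IsHermitian) :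
    (fromBlocks G Cᴴ C H).IsHermitian :=
  IsHermitian.fromBlocks hG (conjTranspose_conjTranspose C) hH

/-- A Hermitian block matrix with positive semidefinite diagonal blocks is positive semidefinite
iff its off-diagonal block satisfies a Cauchy-Schwarz inequality. -/
theorem posSemidef_fromBlocks_iff {G : Matrix I I ℂ} {H : Matrix J J ℂ} {C : Matrix J I ℂ}
    (hG : G.PosSemidef) (hH : H.PosSemidef) :
    (fromBlocks G Cᴴ C H).PosSemidef ↔
      ∀ x y, ‖star y ⬝ᵥ (C *ᵥ x)‖ ^ 2 ≤
        (star x ⬝ᵥ (G *ᵥ x)).re * (star y ⬝ᵥ (H *ᵥ y)).re := by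
  constructor
  · intro h x y
    have hg := (Complex.nonneg_iff.1 (hG.dotProduct_mulVec_nonneg x)).1
    have hh := (Complex.nonneg_iff.1 (hH.dotProduct_mulVec_nonneg y)).1
    set z := star y ⬝ᵥ (C *ᵥ x) with hz
    set g := (star x ⬝ᵥ (G *ᵥ x)).re with hgdef
    set k := (star y ⬝ᵥ (H *ᵥ y)).re with hkdef
    have key : ∀ t : ℝ, 0 ≤ (‖z‖ ^ 2 * g) * (t * t) + (2 * ‖z‖ ^ 2) * t + k := by
      intro t
      have h0 := (Complex.nonneg_iff.1
        (h.dotProduct_mulVec_nonneg (Sum.elim (((t : ℂ) * star z) • x) y))).1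
      rw [star_dotProduct_fromBlocks_mulVec] at h0
      simp only [star_smul, mulVec_smul, dotProduct_smul, smul_dotProduct, smul_eq_mul,
        ← hz] at h0
      have e1 : (t : ℂ) * star z * (star ((t : ℂ) * star z) * (star x ⬝ᵥ (G *ᵥ x)))
          = ((t * t * ‖z‖ ^ 2 : ℝ) : ℂ) * (star x ⬝ᵥ (G *ᵥ x)) := by
        have := Complex.mul_conj' z
        simp only [star_mul', Complex.star_def, Complex.conj_ofReal, Complex.conj_conj]
        push_cast
        rw [← this]; ring
      have e2 : (t : ℂ) * star z * z = ((t * ‖z‖ ^ 2 : ℝ) : ℂ) := by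
        have := Complex.conj_mul' z
        push_cast
        rw [← this, Complex.star_def]; ring
      rw [e2, e1] at h0
      simp only [Complex.add_re, Complex.re_ofReal_mul, Complex.star_def, Complex.conj_ofReal,
        Complex.ofReal_re, ← hgdef, ← hkdef] at h0
      linarith
    have hd := discrim_le_zero key
    rw [discrim] at hd
    by_cases hz0 : ‖z‖ = 0
    · rw [hz0]; simpa using mul_nonneg hg hh
    · have : 0 < ‖z‖ ^ 2 := by positivity
      nlinarith
  · intro h
    refine .of_dotProduct_mulVec_nonneg
      (isHermitian_fromBlocks_conjTranspose C hG.isHermitian hH.isHermitian) fun v => ?_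
    obtain ⟨x, y, rfl⟩ : ∃ x y, v = Sum.elim x y :=
      ⟨v ∘ Sum.inl, v ∘ Sum.inr, (Sum.elim_comp_inl_inr v).symm⟩
    rw [star_dotProduct_fromBlocks_mulVec]
    have hg := Complex.nonneg_iff.1 (hG.dotProduct_mulVec_nonneg x)
    have hh := Complex.nonneg_iff.1 (hH.dotProduct_mulVec_nonneg y)
    have hb := h x y
    set z := star y ⬝ᵥ (C *ᵥ x)
    have h1 : ‖z‖ ≤ ((star x ⬝ᵥ (G *ᵥ x)).re + (star y ⬝ᵥ (H *ᵥ y)).re) / 2 := by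
      refine abs_le_of_sq_le_sq' ?_ (by linarith [hg.1, hh.1]) |>.2
      nlinarith [sq_nonneg ((star x ⬝ᵥ (G *ᵥ x)).re - (star y ⬝ᵥ (H *ᵥ y)).re)]
    have h2 : -‖z‖ ≤ z.re := (abs_le.1 (Complex.abs_re_le_norm z)).1
    rw [Complex.nonneg_iff]
    simp only [Complex.add_re, Complex.add_im, Complex.star_def, Complex.conj_re,
      Complex.conj_im, ← hg.2, ← hh.2]
    constructor
    · linarith
    · ring

/-- Positive semidefinite block matrices are stable under blockwise Kronecker products. -/
theorem Matrix.PosSemidef.fromBlocks_kronecker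
    {G : Matrix I I ℂ} {H : Matrix J J ℂ} {C : Matrix J I ℂ}
    {G' : Matrix I' I' ℂ} {H' : Matrix J' J' ℂ} {C' : Matrix J' I' ℂ}
    (h : (fromBlocks G Cᴴ C H).PosSemidef) (h' : (fromBlocks G' C'ᴴ C' H').PosSemidef) :
    (fromBlocks (G ⊗ₖ G') (C ⊗ₖ C')ᴴ (C ⊗ₖ C') (H ⊗ₖ H')).PosSemidef := by
  have key : ((fromBlocks G Cᴴ C H ⊗ₖ fromBlocks G' C'ᴴ C' H').submatrix
      (Sum.elim (Prod.map Sum.inl Sum.inl) (Prod.map Sum.inr Sum.inr))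
      (Sum.elim (Prod.map Sum.inl Sum.inl) (Prod.map Sum.inr Sum.inr))).PosSemidef :=
    PosSemidef.submatrix (h.kronecker h') _
  convert key using 1
  ext i j
  cases i <;> cases j <;> simp

end Blocks

section Correlation

variable {A B : Type*} [Fintype A] [Fintype B]

theorem trace_ptrB_mul [DecidableEq B] (ρ : Matrix (A × B) (A × B) ℂ) (X : Matrix A A ℂ) :
    (ptrB ρ * X).trace = (ρ * (X ⊗ₖ (1 : Matrix B B ℂ))).trace := by
  simp only [trace, diag_apply, mul_apply, ptrB, kroneckerMap_apply, Fintype.sum_prod_type,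
    one_apply, mul_ite, mul_one, mul_zero, Finset.sum_ite_eq', Finset.mem_univ, if_true,
    Finset.sum_mul]
  exact Finset.sum_congr rfl fun i _ => Finset.sum_comm

theorem trace_ptrA_mul [DecidableEq A] (ρ : Matrix (A × B) (A × B) ℂ) (Y : Matrix B B ℂ) :
    (ptrA ρ * Y).trace = (ρ * ((1 : Matrix A A ℂ) ⊗ₖ Y)).trace := by
  simp only [trace, diag_apply, mul_apply, ptrA, kroneckerMap_apply, Fintype.sum_prod_type,
    one_apply, ite_mul, mul_ite, one_mul, zero_mul, mul_zero, Finset.sum_mul,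
    Finset.sum_ite_irrel, Finset.sum_const_zero, Finset.sum_ite_eq', Finset.mem_univ, if_true]
  rw [Finset.sum_comm]
  exact (Finset.sum_congr rfl fun _ _ => Finset.sum_comm).trans
    (Finset.sum_comm.trans (Finset.sum_congr rfl fun _ _ => Finset.sum_comm))

omit [Fintype A] in
theorem isHermitian_ptrB {ρ : Matrix (A × B) (A × B) ℂ} (hρ : ρ.IsHermitian) :
    (ptrB ρ).IsHermitian := by
  ext i j
  simp only [conjTranspose_apply, ptrB, star_sum]
  exact Finset.sum_congr rfl fun k _ => hρ.apply _ _

omit [Fintype B] in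
theorem isHermitian_ptrA {ρ : Matrix (A × B) (A × B) ℂ} (hρ : ρ.IsHermitian) :
    (ptrA ρ).IsHermitian := by
  ext i j
  simp only [conjTranspose_apply, ptrA, star_sum]
  exact Finset.sum_congr rfl fun k _ => hρ.apply _ _

theorem trace_ptrB (ρ : Matrix (A × B) (A × B) ℂ) : (ptrB ρ).trace = ρ.trace := by
  simp [trace, ptrB, Fintype.sum_prod_type]

theorem trace_ptrA (ρ : Matrix (A × B) (A × B) ℂ) : (ptrA ρ).trace = ρ.trace := by
  simp [trace, ptrA, Fintype.sum_prod_type_right]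

theorem Matrix.IsHermitian.trace_mul_conjTranspose {n : Type*} [Fintype n] {M : Matrix n n ℂ}
    (hM : M.IsHermitian) (X : Matrix n n ℂ) : (M * Xᴴ).trace = star (M * X).trace := by
  rw [← trace_conjTranspose, conjTranspose_mul, hM.eq, trace_mul_comm]

theorem Matrix.IsHermitian.kronecker_one {m n : Type*} [DecidableEq n] {M : Matrix m m ℂ}
    (hM : M.IsHermitian) : (M ⊗ₖ (1 : Matrix n n ℂ)).IsHermitian := by
  rw [IsHermitian, conjTranspose_kronecker, hM.eq, conjTranspose_one]

theorem sub_kronecker {m n : Type*} (X X' : Matrix m m ℂ) (Y : Matrix n n ℂ) :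
    (X - X') ⊗ₖ Y = X ⊗ₖ Y - X' ⊗ₖ Y := by
  ext; simp [sub_mul]

theorem kronecker_sub {m n : Type*} (X : Matrix m m ℂ) (Y Y' : Matrix n n ℂ) :
    X ⊗ₖ (Y - Y') = X ⊗ₖ Y - X ⊗ₖ Y' := by
  ext; simp [mul_sub]

/-- The entries of a square matrix as a vector. -/
def entries {n : Type*} (X : Matrix n n ℂ) : n × n → ℂ := fun p => X p.1 p.2

theorem exists_eq_entries {n : Type*} (x : n × n → ℂ) : ∃ X : Matrix n n ℂ, x = entries X :=
  ⟨Matrix.of fun i j => x (i, j), rfl⟩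

/-- The matrix of the sesquilinear form `tr (ρ (X ⊗ Yᴴ))`. -/
def corrForm {A B : Type*} (ρ : Matrix (A × B) (A × B) ℂ) : Matrix (B × B) (A × A) ℂ :=
  Matrix.of fun q p => ρ (p.2, q.1) (p.1, q.2)

/-- The vector of the linear functional `tr (M X)`. -/
def traceVec {n : Type*} (M : Matrix n n ℂ) : n × n → ℂ := fun p => M p.2 p.1

theorem traceVec_dotProduct_entries {n : Type*} [Fintype n] (M X : Matrix n n ℂ) :
    traceVec M ⬝ᵥ entries X = (M * X).trace := by
  simp only [dotProduct, traceVec, entries, trace, diag_apply, mul_apply, Fintype.sum_prod_type]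
  exact Finset.sum_comm

theorem star_entries_dotProduct_kronecker_one {n : Type*} [Fintype n] [DecidableEq n]
    (M X : Matrix n n ℂ) :
    star (entries X) ⬝ᵥ ((M ⊗ₖ (1 : Matrix n n ℂ)) *ᵥ entries X) = (M * (X * Xᴴ)).trace := by
  simp only [dotProduct, mulVec, entries, trace, diag_apply, mul_apply, Fintype.sum_prod_type,
    kroneckerMap_apply, one_apply, mul_ite, ite_mul, mul_one, mul_zero, zero_mul,
    Finset.sum_ite_eq, Finset.mem_univ, if_true, Pi.star_apply, conjTranspose_apply,
    Finset.mul_sum]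
  refine Finset.sum_congr rfl fun i _ => Finset.sum_comm.trans
    (Finset.sum_congr rfl fun j _ => Finset.sum_congr rfl fun k _ => by ring)

theorem star_entries_dotProduct_corrForm (ρ : Matrix (A × B) (A × B) ℂ) (X : Matrix A A ℂ)
    (Y : Matrix B B ℂ) :
    star (entries Y) ⬝ᵥ (corrForm ρ *ᵥ entries X) = (ρ * (X ⊗ₖ Yᴴ)).trace := by
  simp only [dotProduct, mulVec, entries, trace, diag_apply, mul_apply, Fintype.sum_prod_type,
    kroneckerMap_apply, Pi.star_apply, conjTranspose_apply, corrForm, of_apply, Finset.mul_sum]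
  calc _ = ∑ k, ∑ i, ∑ j, ∑ l, ρ (i, k) (j, l) * (X j i * star (Y k l)) := by
        refine Finset.sum_congr rfl fun k _ => ?_
        rw [Finset.sum_congr rfl fun l _ => Finset.sum_comm, Finset.sum_comm]
        refine Finset.sum_congr rfl fun i _ => Finset.sum_comm.trans ?_
        exact Finset.sum_congr rfl fun j _ => Finset.sum_congr rfl fun l _ => by ring
    _ = _ := Finset.sum_comm

theorem star_dotProduct_vecMulVec_mulVec {I J : Type*} [Fintype I] [Fintype J]
    (u x : I → ℂ) (v y : J → ℂ) :
    star y ⬝ᵥ (vecMulVec (star v) u *ᵥ x) = star (v ⬝ᵥ y) * (u ⬝ᵥ x) := by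
  rw [vecMulVec_mulVec, dotProduct_smul, star_dotProduct_star, dotProduct_comm]
  simp [mul_comm]

end Correlation

section Centered

variable {A B : Type*} [Fintype A] [Fintype B] [DecidableEq A] [DecidableEq B]

theorem posSemidef_fromBlocks_corrForm {ρ : Matrix (A × B) (A × B) ℂ} (hρ : ρ.PosSemidef) :
    (fromBlocks (ptrB ρ ⊗ₖ (1 : Matrix A A ℂ)) (corrForm ρ)ᴴ (corrForm ρ)
      (ptrA ρ ⊗ₖ (1 : Matrix B B ℂ))).PosSemidef := by
  refine .of_dotProduct_mulVec_nonneg (isHermitian_fromBlocks_conjTranspose _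
    ((isHermitian_ptrB hρ.1).kronecker_one)
    ((isHermitian_ptrA hρ.1).kronecker_one)) fun v => ?_
  obtain ⟨x, y, rfl⟩ : ∃ x y, v = Sum.elim x y :=
    ⟨v ∘ Sum.inl, v ∘ Sum.inr, (Sum.elim_comp_inl_inr v).symm⟩
  obtain ⟨X, rfl⟩ := exists_eq_entries x
  obtain ⟨Y, rfl⟩ := exists_eq_entries y
  rw [star_dotProduct_fromBlocks_mulVec, star_entries_dotProduct_kronecker_one,
    star_entries_dotProduct_kronecker_one, star_entries_dotProduct_corrForm]
  have h := (hρ.conjTranspose_mul_mul_same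
    (X ⊗ₖ (1 : Matrix B B ℂ) + (1 : Matrix A A ℂ) ⊗ₖ Y)).trace_nonneg
  rw [Matrix.mul_assoc, trace_mul_comm] at h
  convert h using 1
  rw [Matrix.mul_assoc, ← hρ.1.trace_mul_conjTranspose, trace_ptrB_mul, trace_ptrA_mul,
    ← trace_add, ← trace_add, ← trace_add, ← Matrix.mul_add, ← Matrix.mul_add, ← Matrix.mul_add]
  simp only [conjTranspose_add, conjTranspose_kronecker, Matrix.add_mul, Matrix.mul_add,
    ← mul_kronecker_mul, conjTranspose_one, Matrix.one_mul, Matrix.mul_one,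
    conjTranspose_conjTranspose, trace_add]
  ring

theorem posSemidef_ptrB_kronecker_one {ρ : Matrix (A × B) (A × B) ℂ} (hρ : ρ.PosSemidef) :
    (ptrB ρ ⊗ₖ (1 : Matrix A A ℂ)).PosSemidef :=
  (posSemidef_fromBlocks_corrForm hρ).submatrix Sum.inl

theorem posSemidef_ptrA_kronecker_one {ρ : Matrix (A × B) (A × B) ℂ} (hρ : ρ.PosSemidef) :
    (ptrA ρ ⊗ₖ (1 : Matrix B B ℂ)).PosSemidef :=
  (posSemidef_fromBlocks_corrForm hρ).submatrix Sum.inr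

theorem trace_ptrB_mul_self_nonneg {ρ : Matrix (A × B) (A × B) ℂ} (hρ : ρ.PosSemidef)
    (X : Matrix A A ℂ) : 0 ≤ (ptrB ρ * (X * Xᴴ)).trace := by
  rw [← star_entries_dotProduct_kronecker_one]
  exact (posSemidef_ptrB_kronecker_one hρ).dotProduct_mulVec_nonneg _

theorem trace_ptrA_mul_self_nonneg {ρ : Matrix (A × B) (A × B) ℂ} (hρ : ρ.PosSemidef)
    (Y : Matrix B B ℂ) : 0 ≤ (ptrA ρ * (Y * Yᴴ)).trace := by
  rw [← star_entries_dotProduct_kronecker_one]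
  exact (posSemidef_ptrA_kronecker_one hρ).dotProduct_mulVec_nonneg _

theorem norm_trace_mul_kronecker_sq_le {ρ : Matrix (A × B) (A × B) ℂ} (hρ : ρ.PosSemidef)
    (X : Matrix A A ℂ) (Y : Matrix B B ℂ) :
    ‖(ρ * (X ⊗ₖ Yᴴ)).trace‖ ^ 2 ≤
      (ptrB ρ * (X * Xᴴ)).trace.re * (ptrA ρ * (Y * Yᴴ)).trace.re := by
  have := (posSemidef_fromBlocks_iff (posSemidef_ptrB_kronecker_one hρ)
    (posSemidef_ptrA_kronecker_one hρ)).1 (posSemidef_fromBlocks_corrForm hρ)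
      (entries X) (entries Y)
  rwa [star_entries_dotProduct_kronecker_one, star_entries_dotProduct_kronecker_one,
    star_entries_dotProduct_corrForm] at this

omit [DecidableEq A] [DecidableEq B] in
theorem mu_nonneg (ρ : Matrix (A × B) (A × B) ℂ) : 0 ≤ mu ρ := by
  refine Real.sSup_nonneg ?_
  rintro _ ⟨X, Y, -, -, -, -, rfl⟩
  exact norm_nonneg _

omit [DecidableEq A] [DecidableEq B] in
theorem le_mu {ρ : Matrix (A × B) (A × B) ℂ} (hρ : ρ.PosSemidef) {X : Matrix A A ℂ}
    {Y : Matrix B B ℂ} (hX : (ptrB ρ * X).trace = 0) (hY : (ptrA ρ * Y).trace = 0)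
    (hX' : (ptrB ρ * (X * Xᴴ)).trace = 1) (hY' : (ptrA ρ * (Y * Yᴴ)).trace = 1) :
    ‖(ρ * (X ⊗ₖ Yᴴ)).trace‖ ≤ mu ρ := by
  classical
  refine le_csSup ⟨1, ?_⟩ ⟨X, Y, hX, hY, hX', hY', rfl⟩
  rintro _ ⟨X, Y, -, -, hX, hY, rfl⟩
  have := norm_trace_mul_kronecker_sq_le hρ X Y
  rw [hX, hY] at this
  refine (sq_le_one_iff₀ (norm_nonneg _)).1 (by simpa using this)

/-- The defining inequality of the maximal correlation, without normalization. -/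
theorem norm_trace_mul_kronecker_sq_le_mu {ρ : Matrix (A × B) (A × B) ℂ} (hρ : ρ.PosSemidef)
    {X : Matrix A A ℂ} {Y : Matrix B B ℂ} (hX : (ptrB ρ * X).trace = 0)
    (hY : (ptrA ρ * Y).trace = 0) :
    ‖(ρ * (X ⊗ₖ Yᴴ)).trace‖ ^ 2 ≤
      mu ρ ^ 2 * ((ptrB ρ * (X * Xᴴ)).trace.re * (ptrA ρ * (Y * Yᴴ)).trace.re) := by
  obtain ⟨hg, hgi⟩ := Complex.nonneg_iff.1 (trace_ptrB_mul_self_nonneg hρ X)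
  obtain ⟨hk, hki⟩ := Complex.nonneg_iff.1 (trace_ptrA_mul_self_nonneg hρ Y)
  have hcs := norm_trace_mul_kronecker_sq_le hρ X Y
  have hgc : (ptrB ρ * (X * Xᴴ)).trace = ((ptrB ρ * (X * Xᴴ)).trace.re : ℂ) :=
    Complex.ext rfl (by simp [← hgi])
  have hkc : (ptrA ρ * (Y * Yᴴ)).trace = ((ptrA ρ * (Y * Yᴴ)).trace.re : ℂ) :=
    Complex.ext rfl (by simp [← hki])
  set g := (ptrB ρ * (X * Xᴴ)).trace.re
  set k := (ptrA ρ * (Y * Yᴴ)).trace.re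
  rcases (mul_nonneg hg hk).eq_or_lt with h0 | h0
  · rw [← h0, mul_zero]
    rwa [← h0] at hcs
  · have hg0 : 0 < g := lt_of_le_of_ne hg fun h => by simp [← h] at h0
    have hk0 : 0 < k := lt_of_le_of_ne hk fun h => by simp [← h] at h0
    have hsg : (Real.sqrt g : ℂ) * Real.sqrt g = g := by
      exact_mod_cast Real.mul_self_sqrt hg
    have hsk : (Real.sqrt k : ℂ) * Real.sqrt k = k := by
      exact_mod_cast Real.mul_self_sqrt hk
    have hgne : (Real.sqrt g : ℂ) ≠ 0 := by exact_mod_cast (Real.sqrt_pos.2 hg0).ne'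
    have hkne : (Real.sqrt k : ℂ) ≠ 0 := by exact_mod_cast (Real.sqrt_pos.2 hk0).ne'
    have := le_mu hρ (X := (Real.sqrt g : ℂ)⁻¹ • X) (Y := (Real.sqrt k : ℂ)⁻¹ • Y)
      (by simp [hX]) (by simp [hY])
      (by
        simp only [conjTranspose_smul, Matrix.mul_smul, Matrix.smul_mul, trace_smul, smul_eq_mul,
          hgc, star_inv₀, Complex.star_def, Complex.conj_ofReal]
        rw [← hsg]; field_simp)
      (by
        simp only [conjTranspose_smul, Matrix.mul_smul, Matrix.smul_mul, trace_smul, smul_eq_mul,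
          hkc, star_inv₀, Complex.star_def, Complex.conj_ofReal]
        rw [← hsk]; field_simp)
    simp only [conjTranspose_smul, kronecker_smul, smul_kronecker, Matrix.mul_smul, trace_smul,
      smul_eq_mul, norm_mul, norm_inv, star_inv₀, Complex.star_def, Complex.conj_ofReal,
      Complex.norm_real, Real.norm_of_nonneg (Real.sqrt_nonneg _)] at this
    have h1 : ‖(ρ * (X ⊗ₖ Yᴴ)).trace‖ ≤ mu ρ * (Real.sqrt g * Real.sqrt k) := by
      have hp := Real.sqrt_pos.2 hg0
      have hq := Real.sqrt_pos.2 hk0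
      field_simp at this
      linarith
    calc _ ≤ (mu ρ * (Real.sqrt g * Real.sqrt k)) ^ 2 := by gcongr
      _ = _ := by rw [mul_pow, mul_pow, Real.sq_sqrt hg, Real.sq_sqrt hk]

/-- The correlation form of `ρ` after projecting out the identity operators, with the marginal
forms scaled by `c` on the diagonal. -/
def centeredBlock (ρ : Matrix (A × B) (A × B) ℂ) (c : ℝ) :
    Matrix ((A × A) ⊕ (B × B)) ((A × A) ⊕ (B × B)) ℂ :=
  let C := corrForm ρ - vecMulVec (star (traceVec (ptrA ρ))) (traceVec (ptrB ρ))
  fromBlocks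
    ((c : ℂ) • (ptrB ρ ⊗ₖ (1 : Matrix A A ℂ) -
      vecMulVec (star (traceVec (ptrB ρ))) (traceVec (ptrB ρ))))
    Cᴴ C
    ((c : ℂ) • (ptrA ρ ⊗ₖ (1 : Matrix B B ℂ) -
      vecMulVec (star (traceVec (ptrA ρ))) (traceVec (ptrA ρ))))

theorem trace_center_mul_self {n : Type*} [Fintype n] [DecidableEq n] {M : Matrix n n ℂ}
    (hM : M.IsHermitian) (hM1 : M.trace = 1) (X : Matrix n n ℂ) :
    (M * ((X - (M * X).trace • 1) * (X - (M * X).trace • 1)ᴴ)).trace =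
      (M * (X * Xᴴ)).trace - star (M * X).trace * (M * X).trace := by
  simp only [conjTranspose_sub, conjTranspose_smul, conjTranspose_one, Matrix.sub_mul,
    Matrix.mul_sub, Matrix.smul_mul, Matrix.mul_smul, Matrix.one_mul, Matrix.mul_one,
    trace_sub, trace_smul, hM1, hM.trace_mul_conjTranspose, smul_eq_mul]
  ring

theorem trace_center {n : Type*} [Fintype n] [DecidableEq n] {M : Matrix n n ℂ}
    (hM1 : M.trace = 1) (X : Matrix n n ℂ) :
    (M * (X - (M * X).trace • 1)).trace = 0 := by
  simp [Matrix.mul_sub, hM1]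

theorem trace_mul_kronecker_center {ρ : Matrix (A × B) (A × B) ℂ} (hρ : IsDensity ρ)
    (X : Matrix A A ℂ) (Y : Matrix B B ℂ) :
    (ρ * ((X - (ptrB ρ * X).trace • 1) ⊗ₖ (Y - (ptrA ρ * Y).trace • 1)ᴴ)).trace =
      (ρ * (X ⊗ₖ Yᴴ)).trace - star (ptrA ρ * Y).trace * (ptrB ρ * X).trace := by
  have h1 : (ρ * (X ⊗ₖ (1 : Matrix B B ℂ))).trace = (ptrB ρ * X).trace :=
    (trace_ptrB_mul ρ X).symm
  have h2 : (ρ * ((1 : Matrix A A ℂ) ⊗ₖ Yᴴ)).trace = star (ptrA ρ * Y).trace := by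
    rw [← trace_ptrA_mul, (isHermitian_ptrA hρ.1.1).trace_mul_conjTranspose]
  simp only [conjTranspose_sub, conjTranspose_smul, conjTranspose_one, sub_kronecker,
    kronecker_sub, smul_kronecker, kronecker_smul, Matrix.mul_sub, Matrix.mul_smul, trace_sub,
    trace_smul, h1, h2, smul_eq_mul, one_kronecker_one, Matrix.mul_one, hρ.2]
  ring

theorem star_entries_dotProduct_centered {n : Type*} [Fintype n] [DecidableEq n] {M : Matrix n n ℂ}
    (hM : M.IsHermitian) (hM1 : M.trace = 1) (X : Matrix n n ℂ) :
    star (entries X) ⬝ᵥ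
      ((M ⊗ₖ (1 : Matrix n n ℂ) - vecMulVec (star (traceVec M)) (traceVec M)) *ᵥ entries X) =
      (M * ((X - (M * X).trace • 1) * (X - (M * X).trace • 1)ᴴ)).trace := by
  rw [trace_center_mul_self hM hM1, sub_mulVec, dotProduct_sub,
    star_entries_dotProduct_kronecker_one, star_dotProduct_vecMulVec_mulVec,
    traceVec_dotProduct_entries]

theorem isHermitian_traceVec_centered {n : Type*} [Fintype n] [DecidableEq n] {M : Matrix n n ℂ}
    (hM : M.IsHermitian) :
    (M ⊗ₖ (1 : Matrix n n ℂ) - vecMulVec (star (traceVec M)) (traceVec M)).IsHermitian :=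
  (hM.kronecker_one).sub (posSemidef_vecMulVec_star_self _).1

theorem posSemidef_centered_ptrB {ρ : Matrix (A × B) (A × B) ℂ} (hρ : IsDensity ρ) :
    (ptrB ρ ⊗ₖ (1 : Matrix A A ℂ) -
      vecMulVec (star (traceVec (ptrB ρ))) (traceVec (ptrB ρ))).PosSemidef := by
  refine .of_dotProduct_mulVec_nonneg
    (isHermitian_traceVec_centered (isHermitian_ptrB hρ.1.1)) fun x => ?_
  obtain ⟨X, rfl⟩ := exists_eq_entries x
  rw [star_entries_dotProduct_centered (isHermitian_ptrB hρ.1.1) (trace_ptrB ρ ▸ hρ.2)]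
  exact trace_ptrB_mul_self_nonneg hρ.1 _

theorem posSemidef_centered_ptrA {ρ : Matrix (A × B) (A × B) ℂ} (hρ : IsDensity ρ) :
    (ptrA ρ ⊗ₖ (1 : Matrix B B ℂ) -
      vecMulVec (star (traceVec (ptrA ρ))) (traceVec (ptrA ρ))).PosSemidef := by
  refine .of_dotProduct_mulVec_nonneg
    (isHermitian_traceVec_centered (isHermitian_ptrA hρ.1.1)) fun x => ?_
  obtain ⟨X, rfl⟩ := exists_eq_entries x
  rw [star_entries_dotProduct_centered (isHermitian_ptrA hρ.1.1) (trace_ptrA ρ ▸ hρ.2)]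
  exact trace_ptrA_mul_self_nonneg hρ.1 _

theorem posSemidef_centeredBlock_iff_forall {ρ : Matrix (A × B) (A × B) ℂ} (hρ : IsDensity ρ)
    {c : ℝ} (hc : 0 ≤ c) :
    (centeredBlock ρ c).PosSemidef ↔ ∀ (X : Matrix A A ℂ) (Y : Matrix B B ℂ),
      ‖(ρ * ((X - (ptrB ρ * X).trace • 1) ⊗ₖ (Y - (ptrA ρ * Y).trace • 1)ᴴ)).trace‖ ^ 2 ≤
      c ^ 2 *
        ((ptrB ρ * ((X - (ptrB ρ * X).trace • 1) * (X - (ptrB ρ * X).trace • 1)ᴴ)).trace.re *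
        (ptrA ρ * ((Y - (ptrA ρ * Y).trace • 1) * (Y - (ptrA ρ * Y).trace • 1)ᴴ)).trace.re) := by
  have hc' : (0 : ℂ) ≤ c := by exact_mod_cast hc
  have key (X : Matrix A A ℂ) (Y : Matrix B B ℂ) :
      star (entries Y) ⬝ᵥ ((corrForm ρ -
        vecMulVec (star (traceVec (ptrA ρ))) (traceVec (ptrB ρ))) *ᵥ entries X) =
      (ρ * ((X - (ptrB ρ * X).trace • 1) ⊗ₖ (Y - (ptrA ρ * Y).trace • 1)ᴴ)).trace := by
    rw [trace_mul_kronecker_center hρ, sub_mulVec, dotProduct_sub,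
      star_entries_dotProduct_corrForm, star_dotProduct_vecMulVec_mulVec,
      traceVec_dotProduct_entries, traceVec_dotProduct_entries]
  unfold centeredBlock
  rw [posSemidef_fromBlocks_iff ((posSemidef_centered_ptrB hρ).smul hc')
    ((posSemidef_centered_ptrA hρ).smul hc')]
  constructor
  · intro h X Y
    have := h (entries X) (entries Y)
    rw [key, smul_mulVec, smul_mulVec, dotProduct_smul, dotProduct_smul,
      star_entries_dotProduct_centered (isHermitian_ptrB hρ.1.1) (trace_ptrB ρ ▸ hρ.2),
      star_entries_dotProduct_centered (isHermitian_ptrA hρ.1.1) (trace_ptrA ρ ▸ hρ.2),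
      smul_eq_mul, smul_eq_mul, Complex.re_ofReal_mul, Complex.re_ofReal_mul] at this
    linarith
  · intro h x y
    obtain ⟨X, rfl⟩ := exists_eq_entries x
    obtain ⟨Y, rfl⟩ := exists_eq_entries y
    have := h X Y
    rw [key, smul_mulVec, smul_mulVec, dotProduct_smul, dotProduct_smul,
      star_entries_dotProduct_centered (isHermitian_ptrB hρ.1.1) (trace_ptrB ρ ▸ hρ.2),
      star_entries_dotProduct_centered (isHermitian_ptrA hρ.1.1) (trace_ptrA ρ ▸ hρ.2),
      smul_eq_mul, smul_eq_mul, Complex.re_ofReal_mul, Complex.re_ofReal_mul]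
    linarith

theorem posSemidef_centeredBlock_iff_mu_le {ρ : Matrix (A × B) (A × B) ℂ} (hρ : IsDensity ρ)
    {c : ℝ} (hc : 0 ≤ c) : (centeredBlock ρ c).PosSemidef ↔ mu ρ ≤ c := by
  rw [posSemidef_centeredBlock_iff_forall hρ hc]
  constructor
  · intro h
    refine Real.sSup_le ?_ hc
    rintro _ ⟨X, Y, hX, hY, hX', hY', rfl⟩
    have := h X Y
    rw [hX, hY] at this
    simp only [zero_smul, sub_zero, hX', hY', Complex.one_re, mul_one] at this
    exact abs_le_of_sq_le_sq' this hc |>.2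
  · intro h X Y
    refine (norm_trace_mul_kronecker_sq_le_mu hρ.1 (trace_center (trace_ptrB ρ ▸ hρ.2) X)
      (trace_center (trace_ptrA ρ ▸ hρ.2) Y)).trans ?_
    have h0 := mu_nonneg ρ
    have := (Complex.nonneg_iff.1 (trace_ptrB_mul_self_nonneg hρ.1 (X - (ptrB ρ * X).trace • 1))).1
    have := (Complex.nonneg_iff.1 (trace_ptrA_mul_self_nonneg hρ.1 (Y - (ptrA ρ * Y).trace • 1))).1
    gcongr

end Centered

section Tensor

variable {A B A' B' : Type*}

theorem ptrB_prodState [Fintype B] [Fintype B'] (ρ : Matrix (A × B) (A × B) ℂ)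
    (σ : Matrix (A' × B') (A' × B') ℂ) : ptrB (prodState ρ σ) = ptrB ρ ⊗ₖ ptrB σ := by
  ext i j
  simp only [ptrB, prodState, kroneckerMap_apply, Fintype.sum_prod_type, Finset.sum_mul_sum]

theorem ptrA_prodState [Fintype A] [Fintype A'] (ρ : Matrix (A × B) (A × B) ℂ)
    (σ : Matrix (A' × B') (A' × B') ℂ) : ptrA (prodState ρ σ) = ptrA ρ ⊗ₖ ptrA σ := by
  ext i j
  simp only [ptrA, prodState, kroneckerMap_apply, Fintype.sum_prod_type, Finset.sum_mul_sum]

theorem prodState_eq_submatrix (ρ : Matrix (A × B) (A × B) ℂ)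
    (σ : Matrix (A' × B') (A' × B') ℂ) :
    prodState ρ σ = (ρ ⊗ₖ σ).submatrix (Equiv.prodProdProdComm A A' B B')
      (Equiv.prodProdProdComm A A' B B') := rfl

variable [Fintype A] [Fintype B] [Fintype A'] [Fintype B']

theorem IsDensity.prodState {ρ : Matrix (A × B) (A × B) ℂ} {σ : Matrix (A' × B') (A' × B') ℂ}
    (hρ : IsDensity ρ) (hσ : IsDensity σ) : IsDensity (prodState ρ σ) := by
  classical
  rw [prodState_eq_submatrix]
  refine ⟨PosSemidef.submatrix (hρ.1.kronecker hσ.1) _, ?_⟩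
  have h : ((ρ ⊗ₖ σ).submatrix (Equiv.prodProdProdComm A A' B B')
      (Equiv.prodProdProdComm A A' B B')).trace = (ρ ⊗ₖ σ).trace :=
    Equiv.sum_comp (Equiv.prodProdProdComm A A' B B') fun i => (ρ ⊗ₖ σ) i i
  rw [h, trace_kronecker, hρ.2, hσ.2, one_mul]

/-- The maximal correlation of a tensor product is at most the maximum of those of the factors. -/
theorem mu_prodState_le {ρ : Matrix (A × B) (A × B) ℂ} {σ : Matrix (A' × B') (A' × B') ℂ}
    (hρ : IsDensity ρ) (hσ : IsDensity σ) :
    mu (prodState ρ σ) ≤ max (mu ρ) (mu σ) := by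
  classical
  have hc : 0 ≤ max (mu ρ) (mu σ) := (mu_nonneg ρ).trans (le_max_left _ _)
  have h1 := (posSemidef_centeredBlock_iff_mu_le hρ hc).2 (le_max_left _ _)
  have h2 := (posSemidef_centeredBlock_iff_mu_le hσ hc).2 (le_max_right _ _)
  rw [← posSemidef_centeredBlock_iff_mu_le (hρ.prodState hσ) hc]
  generalize max (mu ρ) (mu σ) = c at *
  have h3 := posSemidef_fromBlocks_corrForm hσ.1
  have h4 : (fromBlocks (vecMulVec (star (traceVec (ptrB ρ))) (traceVec (ptrB ρ)))
      (vecMulVec (star (traceVec (ptrA ρ))) (traceVec (ptrB ρ)))ᴴ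
      (vecMulVec (star (traceVec (ptrA ρ))) (traceVec (ptrB ρ)))
      (vecMulVec (star (traceVec (ptrA ρ))) (traceVec (ptrA ρ)))).PosSemidef := by
    convert posSemidef_vecMulVec_star_self (Sum.elim (traceVec (ptrB ρ)) (traceVec (ptrA ρ)))
      using 1
    ext i j
    cases i <;> cases j <;> simp [vecMulVec_apply, mul_comm]
  have h5 := ((h1.fromBlocks_kronecker h3).add (h4.fromBlocks_kronecker h2)).submatrix
    (Sum.map (Equiv.prodProdProdComm A A' A A') (Equiv.prodProdProdComm B B' B B'))
  convert h5 using 1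
  ext i j
  rcases i with ⟨⟨i, i'⟩, ⟨k, k'⟩⟩ | ⟨⟨i, i'⟩, ⟨k, k'⟩⟩ <;>
    rcases j with ⟨⟨j, j'⟩, ⟨l, l'⟩⟩ | ⟨⟨j, j'⟩, ⟨l, l'⟩⟩ <;>
    simp [centeredBlock, ptrA_prodState, ptrB_prodState, vecMulVec_apply, traceVec, corrForm,
      prodState, one_apply, ite_and] <;> (try split_ifs) <;> ring

end Tensor

section Reduction

variable {A B C D : Type*} [Fintype A] [Fintype B] [Fintype C] [Fintype D]
  [DecidableEq A] [DecidableEq B] [DecidableEq C] [DecidableEq D]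

/-- The maximal correlation does not increase under a reduction whose dual is given by unital
star homomorphisms on the two sides. -/
theorem mu_le_mu_of_trace_eq {τ : Matrix (C × D) (C × D) ℂ} (hτ : τ.PosSemidef)
    (τ' : Matrix (A × B) (A × B) ℂ) (f : Matrix A A ℂ → Matrix C C ℂ)
    (g : Matrix B B ℂ → Matrix D D ℂ) (hf1 : f 1 = 1) (hg1 : g 1 = 1)
    (hf : ∀ X, f (X * Xᴴ) = f X * (f X)ᴴ) (hg : ∀ Y, g (Y * Yᴴ) = g Y * (g Y)ᴴ)
    (hgs : ∀ Y, g Yᴴ = (g Y)ᴴ)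
    (h : ∀ X Y, (τ' * (X ⊗ₖ Y)).trace = (τ * (f X ⊗ₖ g Y)).trace) :
    mu τ' ≤ mu τ := by
  have hB (X : Matrix A A ℂ) : (ptrB τ' * X).trace = (ptrB τ * f X).trace := by
    rw [trace_ptrB_mul, trace_ptrB_mul, h, hg1]
  have hA (Y : Matrix B B ℂ) : (ptrA τ' * Y).trace = (ptrA τ * g Y).trace := by
    rw [trace_ptrA_mul, trace_ptrA_mul, h, hf1]
  refine Real.sSup_le ?_ (mu_nonneg τ)
  rintro _ ⟨X, Y, hX, hY, hX', hY', rfl⟩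
  rw [h, hgs]
  refine le_mu hτ ?_ ?_ ?_ ?_
  · rw [← hB, hX]
  · rw [← hA, hY]
  · rw [← hf, ← hB, hX']
  · rw [← hg, ← hA, hY']

end Reduction

section PartialTrace

variable {A B A' B' : Type*} [Fintype A] [Fintype B] [Fintype A'] [Fintype B']

/-- The reduction of a state of two bipartite systems to the first one. -/
def reduceFst (τ : Matrix ((A × A') × (B × B')) ((A × A') × (B × B')) ℂ) :
    Matrix (A × B) (A × B) ℂ :=
  ptrB (τ.submatrix (Equiv.prodProdProdComm A B A' B') (Equiv.prodProdProdComm A B A' B'))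

/-- The reduction of a state of two bipartite systems to the second one. -/
def reduceSnd (τ : Matrix ((A × A') × (B × B')) ((A × A') × (B × B')) ℂ) :
    Matrix (A' × B') (A' × B') ℂ :=
  ptrA (τ.submatrix (Equiv.prodProdProdComm A B A' B') (Equiv.prodProdProdComm A B A' B'))

theorem trace_reduceFst_mul [DecidableEq A'] [DecidableEq B']
    (τ : Matrix ((A × A') × (B × B')) ((A × A') × (B × B')) ℂ) (X : Matrix A A ℂ)
    (Y : Matrix B B ℂ) :
    (reduceFst τ * (X ⊗ₖ Y)).trace =
      (τ * ((X ⊗ₖ (1 : Matrix A' A' ℂ)) ⊗ₖ (Y ⊗ₖ (1 : Matrix B' B' ℂ)))).trace := by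
  have h : ((X ⊗ₖ Y) ⊗ₖ (1 : Matrix (A' × B') (A' × B') ℂ)) =
      ((X ⊗ₖ (1 : Matrix A' A' ℂ)) ⊗ₖ (Y ⊗ₖ (1 : Matrix B' B' ℂ))).submatrix
        (Equiv.prodProdProdComm A B A' B') (Equiv.prodProdProdComm A B A' B') := by
    rw [← one_kronecker_one]
    ext i j
    simp only [kroneckerMap_apply, submatrix_apply, Equiv.prodProdProdComm_apply]
    ring
  rw [reduceFst, trace_ptrB_mul, h, submatrix_mul_equiv]
  exact Equiv.sum_comp (Equiv.prodProdProdComm A B A' B') fun i =>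
    (τ * ((X ⊗ₖ (1 : Matrix A' A' ℂ)) ⊗ₖ (Y ⊗ₖ (1 : Matrix B' B' ℂ)))) i i

theorem trace_reduceSnd_mul [DecidableEq A] [DecidableEq B]
    (τ : Matrix ((A × A') × (B × B')) ((A × A') × (B × B')) ℂ) (X : Matrix A' A' ℂ)
    (Y : Matrix B' B' ℂ) :
    (reduceSnd τ * (X ⊗ₖ Y)).trace =
      (τ * (((1 : Matrix A A ℂ) ⊗ₖ X) ⊗ₖ ((1 : Matrix B B ℂ) ⊗ₖ Y))).trace := by
  have h : ((1 : Matrix (A × B) (A × B) ℂ) ⊗ₖ (X ⊗ₖ Y)) =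
      (((1 : Matrix A A ℂ) ⊗ₖ X) ⊗ₖ ((1 : Matrix B B ℂ) ⊗ₖ Y)).submatrix
        (Equiv.prodProdProdComm A B A' B') (Equiv.prodProdProdComm A B A' B') := by
    rw [← one_kronecker_one]
    ext i j
    simp only [kroneckerMap_apply, submatrix_apply, Equiv.prodProdProdComm_apply]
    ring
  rw [reduceSnd, trace_ptrA_mul, h, submatrix_mul_equiv]
  exact Equiv.sum_comp (Equiv.prodProdProdComm A B A' B') fun i =>
    (τ * (((1 : Matrix A A ℂ) ⊗ₖ X) ⊗ₖ ((1 : Matrix B B ℂ) ⊗ₖ Y))) i i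

theorem mu_reduceFst_le {τ : Matrix ((A × A') × (B × B')) ((A × A') × (B × B')) ℂ}
    (hτ : τ.PosSemidef) : mu (reduceFst τ) ≤ mu τ := by
  classical
  exact mu_le_mu_of_trace_eq hτ _ (· ⊗ₖ 1) (· ⊗ₖ 1) one_kronecker_one one_kronecker_one
    (fun X => by simp [conjTranspose_kronecker, ← mul_kronecker_mul])
    (fun X => by simp [conjTranspose_kronecker, ← mul_kronecker_mul])
    (fun X => by simp [conjTranspose_kronecker])
    (trace_reduceFst_mul τ)

theorem mu_reduceSnd_le {τ : Matrix ((A × A') × (B × B')) ((A × A') × (B × B')) ℂ}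
    (hτ : τ.PosSemidef) : mu (reduceSnd τ) ≤ mu τ := by
  classical
  exact mu_le_mu_of_trace_eq hτ _ (1 ⊗ₖ ·) (1 ⊗ₖ ·) one_kronecker_one one_kronecker_one
    (fun X => by simp [conjTranspose_kronecker, ← mul_kronecker_mul])
    (fun X => by simp [conjTranspose_kronecker, ← mul_kronecker_mul])
    (fun X => by simp [conjTranspose_kronecker])
    (trace_reduceSnd_mul τ)

theorem IsDensity.ptrB {ρ : Matrix (A × B) (A × B) ℂ} (hρ : IsDensity ρ) :
    IsDensity (_root_.ptrB ρ) := by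
  refine ⟨?_, by rw [trace_ptrB, hρ.2]⟩
  have h : _root_.ptrB ρ = ∑ k, ρ.submatrix (fun i => (i, k)) fun i => (i, k) := by
    ext i j
    simp [_root_.ptrB, Matrix.sum_apply]
  rw [h]
  exact posSemidef_sum _ fun k _ => hρ.1.submatrix _

theorem IsDensity.ptrA {ρ : Matrix (A × B) (A × B) ℂ} (hρ : IsDensity ρ) :
    IsDensity (_root_.ptrA ρ) := by
  refine ⟨?_, by rw [trace_ptrA, hρ.2]⟩
  have h : _root_.ptrA ρ = ∑ i, ρ.submatrix (fun k => (i, k)) fun k => (i, k) := by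
    ext k l
    simp [_root_.ptrA, Matrix.sum_apply]
  rw [h]
  exact posSemidef_sum _ fun i _ => hρ.1.submatrix _

theorem IsDensity.submatrix_equiv {m n : Type*} [Fintype m] [Fintype n] {ρ : Matrix n n ℂ}
    (hρ : IsDensity ρ) (e : m ≃ n) : IsDensity (ρ.submatrix e e) :=
  ⟨hρ.1.submatrix _, (Equiv.sum_comp e fun i => ρ i i).trans hρ.2⟩

omit [Fintype A] [Fintype B] in
theorem reduceFst_prodState {ρ : Matrix (A × B) (A × B) ℂ} {σ : Matrix (A' × B') (A' × B') ℂ}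
    (hσ : σ.trace = 1) : reduceFst (prodState ρ σ) = ρ := by
  ext i j
  simp only [reduceFst, ptrB, submatrix_apply, prodState, Equiv.prodProdProdComm_apply,
    ← Finset.mul_sum]
  exact (congrArg (ρ i j * ·) hσ).trans (mul_one _)

omit [Fintype A'] [Fintype B'] in
theorem reduceSnd_prodState {ρ : Matrix (A × B) (A × B) ℂ} {σ : Matrix (A' × B') (A' × B') ℂ}
    (hρ : ρ.trace = 1) : reduceSnd (prodState ρ σ) = σ := by
  ext i j
  simp only [reduceSnd, ptrA, submatrix_apply, prodState, Equiv.prodProdProdComm_apply,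
    ← Finset.sum_mul]
  exact (congrArg (· * σ i j) hρ).trans (one_mul _)

omit [Fintype A] [Fintype B] in
theorem reduceFst_sum_smul {ι : Type*} [Fintype ι] (p : ι → ℝ)
    (τ : ι → Matrix ((A × A') × (B × B')) ((A × A') × (B × B')) ℂ) :
    reduceFst (∑ i, p i • τ i) = ∑ i, p i • reduceFst (τ i) := by
  ext x y
  simp only [reduceFst, ptrB, submatrix_apply, Matrix.sum_apply, Matrix.smul_apply,
    Finset.smul_sum]
  exact Finset.sum_comm

omit [Fintype A'] [Fintype B'] in
theorem reduceSnd_sum_smul {ι : Type*} [Fintype ι] (p : ι → ℝ)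
    (τ : ι → Matrix ((A × A') × (B × B')) ((A × A') × (B × B')) ℂ) :
    reduceSnd (∑ i, p i • τ i) = ∑ i, p i • reduceSnd (τ i) := by
  ext x y
  simp only [reduceSnd, ptrA, submatrix_apply, Matrix.sum_apply, Matrix.smul_apply,
    Finset.smul_sum]
  exact Finset.sum_comm

end PartialTrace

section Decompositions

variable {A B A' B' : Type*} [Fintype A] [Fintype B] [Fintype A'] [Fintype B']

theorem muEnt_le_of_decomposition {ι : Type*} [Fintype ι] {ρ : Matrix (A × B) (A × B) ℂ}
    {p : ι → ℝ} {τ : ι → Matrix (A × B) (A × B) ℂ} (hp : ∀ i, 0 ≤ p i) (hp1 : ∑ i, p i = 1)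
    (hτ : ∀ i, IsDensity (τ i)) (h : ρ = ∑ i, p i • τ i) {c : ℝ} (hc : 0 ≤ c)
    (hmu : ∀ i, mu (τ i) ≤ c) : muEnt ρ ≤ c := by
  let e := (Fintype.equivFin ι).symm
  refine le_trans (b := ⨆ i, mu (τ (e i))) (csInf_le ⟨0, ?_⟩ ⟨_, p ∘ e, τ ∘ e, fun i => hp _,
    ?_, fun i => hτ _, ?_, rfl⟩) (Real.iSup_le (fun i => hmu _) hc)
  · rintro _ ⟨m, p, τ, -, -, -, -, rfl⟩
    exact Real.iSup_nonneg fun i => mu_nonneg _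
  · rw [← hp1]
    exact e.sum_comp p
  · rw [h]
    exact (e.sum_comp fun i => p i • τ i).symm

theorem muEnt_nonneg (ρ : Matrix (A × B) (A × B) ℂ) : 0 ≤ muEnt ρ := by
  refine Real.sInf_nonneg ?_
  rintro _ ⟨m, p, τ, -, -, -, -, rfl⟩
  exact Real.iSup_nonneg fun i => mu_nonneg _

theorem exists_decomposition_of_muEnt_lt {ρ : Matrix (A × B) (A × B) ℂ} (hρ : IsDensity ρ)
    {c : ℝ} (hc : muEnt ρ < c) :
    ∃ (m : ℕ) (p : Fin m → ℝ) (τ : Fin m → Matrix (A × B) (A × B) ℂ),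
      (∀ i, 0 ≤ p i) ∧ (∑ i, p i) = 1 ∧ (∀ i, IsDensity (τ i)) ∧
      ρ = ∑ i, p i • τ i ∧ ∀ i, mu (τ i) < c := by
  obtain ⟨_, ⟨m, p, τ, hp, hp1, hτ, h, rfl⟩, hlt⟩ := exists_lt_of_csInf_lt
    (by exact ⟨_, 1, fun _ => 1, fun _ => ρ, by simp, by simp, fun _ => hρ, by simp, rfl⟩) hc
  exact ⟨m, p, τ, hp, hp1, hτ, h, fun i =>
    (le_ciSup (Set.finite_range fun i => mu (τ i)).bddAbove i).trans_lt hlt⟩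

theorem muEnt_prodState_le {ρ : Matrix (A × B) (A × B) ℂ} {σ : Matrix (A' × B') (A' × B') ℂ}
    (hρ : IsDensity ρ) (hσ : IsDensity σ) :
    muEnt (prodState ρ σ) ≤ max (muEnt ρ) (muEnt σ) := by
  refine le_of_forall_gt_imp_ge_of_dense fun c hc => ?_
  obtain ⟨hc1, hc2⟩ := max_lt_iff.1 hc
  obtain ⟨m, p, τ, hp, hp1, hτ, rfl, hmu⟩ := exists_decomposition_of_muEnt_lt hρ hc1
  obtain ⟨n, q, ω, hq, hq1, hω, rfl, hmu'⟩ := exists_decomposition_of_muEnt_lt hσ hc2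
  refine muEnt_le_of_decomposition (ι := Fin m × Fin n) (p := fun i => p i.1 * q i.2)
    (τ := fun i => prodState (τ i.1) (ω i.2)) (fun i => mul_nonneg (hp _) (hq _)) ?_
    (fun i => (hτ _).prodState (hω _)) ?_ ((muEnt_nonneg _).trans hc1.le) fun i =>
      (mu_prodState_le (hτ _) (hω _)).trans (max_le (hmu _).le (hmu' _).le)
  · rw [Fintype.sum_prod_type, ← Finset.sum_mul_sum, hp1, hq1, one_mul]
  · ext x y
    simp only [prodState, Matrix.sum_apply, Matrix.smul_apply, Finset.sum_mul_sum,
      Fintype.sum_prod_type, Complex.real_smul, Complex.ofReal_mul]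
    exact Finset.sum_congr rfl fun i _ => Finset.sum_congr rfl fun j _ => by ring

theorem muEnt_le_muEnt_prodState_left {ρ : Matrix (A × B) (A × B) ℂ}
    {σ : Matrix (A' × B') (A' × B') ℂ} (hρ : IsDensity ρ) (hσ : IsDensity σ) :
    muEnt ρ ≤ muEnt (prodState ρ σ) := by
  refine le_of_forall_gt_imp_ge_of_dense fun c hc => ?_
  obtain ⟨m, p, τ, hp, hp1, hτ, h, hmu⟩ :=
    exists_decomposition_of_muEnt_lt (hρ.prodState hσ) hc
  refine muEnt_le_of_decomposition (τ := fun i => reduceFst (τ i)) hp hp1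
    (fun i => ((hτ i).submatrix_equiv _).ptrB) ?_ ((muEnt_nonneg _).trans hc.le)
    fun i => (mu_reduceFst_le (hτ i).1).trans (hmu i).le
  rw [← reduceFst_sum_smul, ← h, reduceFst_prodState hσ.2]

theorem muEnt_le_muEnt_prodState_right {ρ : Matrix (A × B) (A × B) ℂ}
    {σ : Matrix (A' × B') (A' × B') ℂ} (hρ : IsDensity ρ) (hσ : IsDensity σ) :
    muEnt σ ≤ muEnt (prodState ρ σ) := by
  refine le_of_forall_gt_imp_ge_of_dense fun c hc => ?_
  obtain ⟨m, p, τ, hp, hp1, hτ, h, hmu⟩ :=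
    exists_decomposition_of_muEnt_lt (hρ.prodState hσ) hc
  refine muEnt_le_of_decomposition (τ := fun i => reduceSnd (τ i)) hp hp1
    (fun i => ((hτ i).submatrix_equiv _).ptrA) ?_ ((muEnt_nonneg _).trans hc.le)
    fun i => (mu_reduceSnd_le (hτ i).1).trans (hmu i).le
  rw [← reduceSnd_sum_smul, ← h, reduceSnd_prodState hρ.2]

end Decompositions

/-- Maximal entanglement of a tensor product state is the max of the maximal entanglements. -/
theorem muEnt_prodState {dA dB dA' dB' : ℕ}
    (ρ : Matrix (Fin dA × Fin dB) (Fin dA × Fin dB) ℂ)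
    (σ : Matrix (Fin dA' × Fin dB') (Fin dA' × Fin dB') ℂ)
    (hρ : IsDensity ρ) (hσ : IsDensity σ) :
    muEnt (prodState ρ σ) = max (muEnt ρ) (muEnt σ) := by
  exact le_antisymm (muEnt_prodState_le hρ hσ) (max_le (muEnt_le_muEnt_prodState_left hρ hσ)
    (muEnt_le_muEnt_prodState_right hρ hσ))
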